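/- Let p = (p0,p1,p2) ∈ [0,1)³ be self-dual (κ_△(p) = 0) with p0 > 0. Then for every α > 1 and every N ∈ ℕ, P^△_p[C_h((α−1)N, 2N)] ≥ P^□_{(p0, 1−p0)}[C_h(αN, N)]. -/

import Mathlib

open MeasureTheory Set

set_option linter.unusedVariables false

namespace Perc

/-- Points of the plane. -/
abbrev Pt := ℝ × ℝ

/-- A lattice embedded in the plane, with edges indexed by `E`;
each edge is embedded as the segment between the two endpoints given by `ends`. -/
structure LatticeOn (E : Type) where
  ends : E → Pt × Pt

/-- Bond configurations. -/
abbrev Config (E : Type) := E → Bool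

/-- `P` is the Bernoulli bond-percolation product measure in which edge `e`
is open with probability `p e`, independently over edges. -/
def IsBernoulliProduct {E : Type} (p : E → ℝ) (P : Measure (Config E)) : Prop :=
  IsProbabilityMeasure P ∧
    ∀ (s : Finset E) (f : E → Bool),
      P {ω | ∀ e ∈ s, ω e = f e} =
        ∏ e ∈ s, ENNReal.ofReal (if f e then p e else 1 - p e)

/-- The union of the closed segments of the open edges. -/
def openEdgeSet {E : Type} (L : LatticeOn E) (ω : Config E) : Set Pt :=
  ⋃ e ∈ {e : E | ω e = true}, segment ℝ (L.ends e).1 (L.ends e).2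

/-- There is an arc, contained in `S` and in the union of the open edges,
with one endpoint in `A` and the other in `B`. -/
def CrossingIn {E : Type} (L : LatticeOn E) (ω : Config E) (S A B : Set Pt) : Prop :=
  ∃ γ : ℝ → Pt, ContinuousOn γ (Icc 0 1) ∧ γ 0 ∈ A ∧ γ 1 ∈ B ∧
    ∀ t ∈ Icc (0:ℝ) 1, γ t ∈ S ∩ openEdgeSet L ω

/-- Rotation of the plane by angle `θ`. -/
noncomputable def rot (θ : ℝ) (z : Pt) : Pt :=
  (Real.cos θ * z.1 - Real.sin θ * z.2, Real.sin θ * z.1 + Real.cos θ * z.2)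

/-- `f` comprises a rotation and a translation. -/
def IsRotTrans (f : Pt → Pt) : Prop := ∃ θ : ℝ, ∃ t : Pt, f = fun z => rot θ z + t

def stdRect (h l : ℝ) : Set Pt := {z | 0 ≤ z.1 ∧ z.1 ≤ h ∧ 0 ≤ z.2 ∧ z.2 ≤ l}
def leftSide (h l : ℝ) : Set Pt := {z | z.1 = 0 ∧ 0 ≤ z.2 ∧ z.2 ≤ l}
def rightSide (h l : ℝ) : Set Pt := {z | z.1 = h ∧ 0 ≤ z.2 ∧ z.2 ≤ l}
def bottomSide (h l : ℝ) : Set Pt := {z | z.2 = 0 ∧ 0 ≤ z.1 ∧ z.1 ≤ h}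
def topSide (h l : ℝ) : Set Pt := {z | z.2 = l ∧ 0 ≤ z.1 ∧ z.1 ≤ h}

/-- The box `f(stdRect h l)` (where `f` is a rotation plus translation) possesses
open crossings in both directions. -/
def HasBoxCrossings {E : Type} (L : LatticeOn E) (ω : Config E) (h l : ℝ) (f : Pt → Pt) : Prop :=
  CrossingIn L ω (f '' stdRect h l) (f '' leftSide h l) (f '' rightSide h l) ∧
  CrossingIn L ω (f '' stdRect h l) (f '' bottomSide h l) (f '' topSide h l)

/-- The box-crossing property: for every `α > 0` there is `δ > 0` such that every box
of size `αN × N` (any position and orientation) possesses open crossings with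
probability at least `δ`, for all large `N`. -/
def BoxCrossingProperty {E : Type} (L : LatticeOn E) (P : Measure (Config E)) : Prop :=
  ∀ α : ℝ, 0 < α → ∃ δ : ℝ, 0 < δ ∧ ∃ N₀ : ℕ, ∀ N : ℕ, N₀ ≤ N →
    ∀ f : Pt → Pt, IsRotTrans f →
      ENNReal.ofReal δ ≤ P {ω | HasBoxCrossings L ω (α * N) N f}

/-- Horizontal-crossing event of the box `[-m,m] × [0,n]`. -/
def Ch {E : Type} (L : LatticeOn E) (m n : ℝ) (ω : Config E) : Prop :=
  CrossingIn L ω {z | -m ≤ z.1 ∧ z.1 ≤ m ∧ 0 ≤ z.2 ∧ z.2 ≤ n}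
    {z | z.1 = -m ∧ 0 ≤ z.2 ∧ z.2 ≤ n} {z | z.1 = m ∧ 0 ≤ z.2 ∧ z.2 ≤ n}

/-- Vertical-crossing event of the box `[-m,m] × [0,n]`. -/
def Cv {E : Type} (L : LatticeOn E) (m n : ℝ) (ω : Config E) : Prop :=
  CrossingIn L ω {z | -m ≤ z.1 ∧ z.1 ≤ m ∧ 0 ≤ z.2 ∧ z.2 ≤ n}
    {z | z.2 = 0 ∧ -m ≤ z.1 ∧ z.1 ≤ m} {z | z.2 = n ∧ -m ≤ z.1 ∧ z.1 ≤ m}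

/-- `u` and `v` are the endpoints of some open edge. -/
def openAdj {E : Type} (L : LatticeOn E) (ω : Config E) (u v : Pt) : Prop :=
  ∃ e, ω e = true ∧ (L.ends e = (u, v) ∨ L.ends e = (v, u))

/-- `u` and `v` are joined by a path of open edges. -/
def openConn {E : Type} (L : LatticeOn E) (ω : Config E) : Pt → Pt → Prop :=
  Relation.ReflTransGen (openAdj L ω)

/-- The open cluster at `v`. -/
def cluster {E : Type} (L : LatticeOn E) (ω : Config E) (v : Pt) : Set Pt :=
  {u | openConn L ω v u}

/-- The vertex set of the lattice. -/
def vertexSet {E : Type} (L : LatticeOn E) : Set Pt :=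
  ⋃ e : E, {(L.ends e).1, (L.ends e).2}

/-- `v` is the endpoint of an infinite open self-avoiding path. -/
def ConnToInfinity {E : Type} (L : LatticeOn E) (ω : Config E) (v : Pt) : Prop :=
  ∃ γ : ℕ → Pt, γ 0 = v ∧ Function.Injective γ ∧ ∀ n, openAdj L ω (γ n) (γ (n + 1))

/-- Euclidean distance on the plane. -/
noncomputable def edist2 (u v : Pt) : ℝ := Real.sqrt ((u.1 - v.1) ^ 2 + (u.2 - v.2) ^ 2)

/-- `rad (C_v) ≥ r`, where `rad (C_v)` is the supremum of all `x` such that `C_v`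
meets the complement of the open Euclidean ball `v + S_x`. -/
def RadiusGE {E : Type} (L : LatticeOn E) (ω : Config E) (v : Pt) (r : ℝ) : Prop :=
  ∀ x : ℝ, x < r → ∃ u ∈ cluster L ω v, x ≤ edist2 v u

/-- `κ_□`. -/
def kappaS (a b : ℝ) : ℝ := a + b - 1
/-- `κ_△`. -/
def kappaT (a b c : ℝ) : ℝ := a + b + c - a * b * c - 1
/-- `κ_⬡`. -/
def kappaH (a b c : ℝ) : ℝ := -kappaT (1 - a) (1 - b) (1 - c)

/-- Edges of a square-type lattice: `(a, b, true)` is the `horizontal`-class edge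
at `(a,b)` and `(a, b, false)` the `vertical`-class edge at `(a,b)`. -/
abbrev SqE := ℤ × ℤ × Bool
/-- Edges of the triangular lattice (also indexing the dual hexagonal edges):
`(a, b, i)` with `i = 0` horizontal, `i = 1` the right edge of an upwards pointing
triangle, `i = 2` the left edge of an upwards pointing triangle, in row `b`. -/
abbrev TriE := ℤ × ℤ × Fin 3

/-- The unit square lattice, with vertex set `ℤ²`. -/
noncomputable def sqLattice : LatticeOn SqE :=
  ⟨fun e =>
    if e.2.2 then (((e.1 : ℝ), (e.2.1 : ℝ)), ((e.1 : ℝ) + 1, (e.2.1 : ℝ)))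
    else (((e.1 : ℝ), (e.2.1 : ℝ)), ((e.1 : ℝ), (e.2.1 : ℝ) + 1))⟩

/-- The dual of the unit square lattice (shifted by `(1/2, 1/2)`), with each dual edge
indexed by the primal edge it crosses. -/
noncomputable def sqDualLattice : LatticeOn SqE :=
  ⟨fun e =>
    if e.2.2 then
      (((e.1 : ℝ) + 1 / 2, (e.2.1 : ℝ) - 1 / 2), ((e.1 : ℝ) + 1 / 2, (e.2.1 : ℝ) + 1 / 2))
    else
      (((e.1 : ℝ) - 1 / 2, (e.2.1 : ℝ) + 1 / 2), ((e.1 : ℝ) + 1 / 2, (e.2.1 : ℝ) + 1 / 2))⟩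

/-- Vertices of the triangular lattice (equilateral triangles of side `√3`,
one family of edges horizontal). -/
noncomputable def tv (a b : ℤ) : Pt :=
  (Real.sqrt 3 * ((a : ℝ) + (b : ℝ) / 2), 3 / 2 * (b : ℝ))

/-- The triangular lattice. -/
noncomputable def triLattice : LatticeOn TriE :=
  ⟨fun e =>
    if e.2.2 = 0 then (tv e.1 e.2.1, tv (e.1 + 1) e.2.1)
    else if e.2.2 = 1 then (tv (e.1 + 1) e.2.1, tv e.1 (e.2.1 + 1))
    else (tv e.1 e.2.1, tv e.1 (e.2.1 + 1))⟩

/-- Circumcentre of the upwards pointing triangle with base vertex `tv a b`. -/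
noncomputable def hup (a b : ℤ) : Pt :=
  (Real.sqrt 3 * ((a : ℝ) + ((b : ℝ) + 1) / 2), 3 / 2 * (b : ℝ) + 1 / 2)

/-- Circumcentre of the downwards pointing triangle below the edge `tv a b – tv (a+1) b`. -/
noncomputable def hdown (a b : ℤ) : Pt :=
  (Real.sqrt 3 * ((a : ℝ) + ((b : ℝ) + 1) / 2), 3 / 2 * (b : ℝ) - 1 / 2)

/-- The hexagonal lattice, the planar dual of `triLattice`, with vertices at the
circumcentres of the triangles; each hexagonal edge is indexed by the triangular
edge it crosses. -/
noncomputable def hexLattice : LatticeOn TriE :=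
  ⟨fun e =>
    if e.2.2 = 0 then (hdown e.1 e.2.1, hup e.1 e.2.1)
    else if e.2.2 = 1 then (hup e.1 e.2.1, hdown e.1 (e.2.1 + 1))
    else (hup e.1 e.2.1, hdown (e.1 - 1) (e.2.1 + 1))⟩

/-- The square lattice with horizontal edges of length `√3` and vertical edges of
length `1` (as in the mixed lattices). -/
noncomputable def sqStretch : LatticeOn SqE :=
  ⟨fun e =>
    if e.2.2 then
      ((Real.sqrt 3 * (e.1 : ℝ), (e.2.1 : ℝ)), (Real.sqrt 3 * ((e.1 : ℝ) + 1), (e.2.1 : ℝ)))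
    else ((Real.sqrt 3 * (e.1 : ℝ), (e.2.1 : ℝ)), (Real.sqrt 3 * (e.1 : ℝ), (e.2.1 : ℝ) + 1))⟩

/-- Vertices of the square lattice rotated by `π/4`. -/
noncomputable def rv (a b : ℤ) : Pt :=
  (((a : ℝ) - (b : ℝ)) / Real.sqrt 2, ((a : ℝ) + (b : ℝ)) / Real.sqrt 2)

/-- The square lattice rotated by `π/4`: edges `(a,b,true)` are inclined at angle `π/4`
and edges `(a,b,false)` at angle `3π/4`; the row (height) of such an edge is `a + b`. -/
noncomputable def rsqLattice : LatticeOn SqE :=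
  ⟨fun e =>
    if e.2.2 then (rv e.1 e.2.1, rv (e.1 + 1) e.2.1)
    else (rv e.1 e.2.1, rv e.1 (e.2.1 + 1))⟩

/-- Inhomogeneous intensities on the square lattice: `ph` on horizontal edges,
`pv` on vertical ones. -/
def sqInt (ph pv : ℝ) : SqE → ℝ := fun e => if e.2.2 then ph else pv

/-- Inhomogeneous intensities on the triangular (or hexagonal) lattice:
`p0` on class-0 edges, `p1` on class-1, `p2` on class-2. -/
def triInt (p0 p1 p2 : ℝ) : TriE → ℝ := fun e => ![p0, p1, p2] e.2.2

/-- Highly inhomogeneous intensities on the triangular (or hexagonal) lattice: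
`p` on horizontal-class edges, `q n` on right edges of upwards pointing triangles at
height `n`, `q' n` on left edges of upwards pointing triangles at height `n`. -/
def triHI (p : ℝ) (q q' : ℤ → ℝ) : TriE → ℝ := fun e =>
  if e.2.2 = 0 then p else if e.2.2 = 1 then q e.2.1 else q' e.2.1

/-- Highly inhomogeneous intensities on the rotated square lattice: `q n` on edges
inclined at `π/4` at height `n`, `q' n` on edges inclined at `3π/4` at height `n`. -/
def rsqHI (q q' : ℤ → ℝ) : SqE → ℝ := fun e =>
  if e.2.2 then q (e.1 + e.2.1) else q' (e.1 + e.2.1)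


open scoped unitInterval

/-- Some point of `A` is joined to some point of `B` by a path of edges in `S`. -/
def Linked {V : Type} (A B : Set V) (S : Set (V × V)) : Prop :=
  ∃ a ∈ A, ∃ b ∈ B, Relation.EqvGen (fun x y => (x, y) ∈ S) a b

lemma Linked.mono {V : Type} {A A' B B' : Set V} {S S' : Set (V × V)} (hA : A ⊆ A')
    (hB : B ⊆ B') (hS : S ⊆ S') (h : Linked A B S) : Linked A' B' S' := by
  obtain ⟨a, ha, b, hb, hab⟩ := h
  exact ⟨a, hA ha, b, hB hb, Relation.EqvGen.mono (fun _ _ h => hS h) a b hab⟩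

lemma eqvGen_map {V W : Type} {r : V → V → Prop} {s : W → W → Prop} (f : V → W)
    (h : ∀ x y, r x y → Relation.EqvGen s (f x) (f y)) {a b : V} (hab : Relation.EqvGen r a b) :
    Relation.EqvGen s (f a) (f b) := by
  induction hab with
  | rel x y hxy => exact h x y hxy
  | refl x => exact .refl _
  | symm x y _ ih => exact .symm _ _ ih
  | trans x y z _ _ ih₁ ih₂ => exact .trans _ _ _ ih₁ ih₂

lemma Linked.map {V W : Type} {A B : Set V} {A' B' : Set W} {S : Set (V × V)} {S' : Set (W × W)}
    (f : V → W) (hA : ∀ a ∈ A, f a ∈ A') (hB : ∀ b ∈ B, f b ∈ B')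
    (hS : ∀ g : W → Prop, (∀ e ∈ S', g e.1 = g e.2) → ∀ e ∈ S, g (f e.1) = g (f e.2))
    (h : Linked A B S) : Linked A' B' S' := by
  obtain ⟨a, ha, b, hb, hab⟩ := h
  refine ⟨f a, hA a ha, f b, hB b hb, eqvGen_map f (fun x y hxy => ?_) hab⟩
  have := hS (Relation.EqvGen (fun x y => (x, y) ∈ S') (f x)) (fun e he => propext
    ⟨fun h => .trans _ _ _ h (.rel _ _ he), fun h => .trans _ _ _ h (.symm _ _ (.rel _ _ he))⟩)
    (x, y) hxy
  exact this.mp (.refl _)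

/-- Averaging over the state of a single edge with a prescribed probability of being open. -/
def edgeStep {V : Type} (e : (V × V) × I) (F : Set (V × V) → ℝ) (S : Set (V × V)) : ℝ :=
  e.2 * F (insert e.1 S) + (1 - e.2) * F S

instance {V : Type} : LeftCommutative (edgeStep (V := V)) where
  left_comm e e' F := by
    funext S
    simp only [edgeStep, Set.insert_comm e.1 e'.1]
    ring

open Classical in
/-- The probability that `A` and `B` are linked when the edges of `S` are open and those of the
weighted graph `G` are open independently with the given probabilities. -/
noncomputable def linkProb {V : Type} (A B : Set V) (G : Multiset ((V × V) × I)) :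
    Set (V × V) → ℝ :=
  G.foldr edgeStep fun S => if Linked A B S then 1 else 0

section LinkProb

variable {V : Type} {A A' B B' : Set V} {S S' : Set (V × V)} {G H : Multiset ((V × V) × I)}

open Classical in
lemma linkProb_zero : linkProb A B 0 S = if Linked A B S then 1 else 0 := rfl

lemma linkProb_cons (e : (V × V) × I) :
    linkProb A B (e ::ₘ G) S =
      e.2 * linkProb A B G (insert e.1 S) + (1 - e.2) * linkProb A B G S := by
  simp [linkProb, edgeStep]

lemma linkProb_singleton_add (e : (V × V) × I) :
    linkProb A B ({e} + G) S =
      e.2 * linkProb A B G (insert e.1 S) + (1 - e.2) * linkProb A B G S := by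
  rw [Multiset.singleton_add, linkProb_cons]

lemma linkProb_singleton (e : (V × V) × I) :
    linkProb A B {e} S =
      e.2 * linkProb A B 0 (insert e.1 S) + (1 - e.2) * linkProb A B 0 S := by
  rw [← Multiset.cons_zero, linkProb_cons]

lemma linkProb_zero_le_of_imp (h : Linked A B S → Linked A' B' S') :
    linkProb A B 0 S ≤ linkProb A' B' 0 S' := by
  simp only [linkProb_zero]
  split_ifs with h₁ h₂ <;> first | exact absurd (h h₁) h₂ | norm_num

lemma convex_comb_le {w x x' y y' : ℝ} (h0 : 0 ≤ w) (h1 : w ≤ 1) (hx : x ≤ x') (hy : y ≤ y') :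
    w * x + (1 - w) * y ≤ w * x' + (1 - w) * y' := by
  have := sub_nonneg.2 h1
  gcongr

lemma linkProb_mono (hA : A ⊆ A') (hB : B ⊆ B') (hS : S ⊆ S') :
    linkProb A B G S ≤ linkProb A' B' G S' := by
  induction G using Multiset.induction_on generalizing S S' with
  | empty => exact linkProb_zero_le_of_imp (Linked.mono hA hB hS)
  | cons e G ih =>
    rw [linkProb_cons, linkProb_cons]
    exact convex_comb_le e.2.2.1 e.2.2.2 (ih (Set.insert_subset_insert hS)) (ih hS)

lemma linkProb_le_cons (e : (V × V) × I) : linkProb A B G S ≤ linkProb A B (e ::ₘ G) S := by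
  rw [linkProb_cons]
  have h := linkProb_mono (A := A) (B := B) (G := G) subset_rfl subset_rfl
    (Set.subset_insert e.1 S)
  have := convex_comb_le e.2.2.1 e.2.2.2 h (le_refl (linkProb A B G S))
  linarith

lemma linkProb_mono_graph (h : G ≤ H) : linkProb A B G S ≤ linkProb A B H S := by
  obtain ⟨K, rfl⟩ := Multiset.le_iff_exists_add.1 h
  clear h
  induction K using Multiset.induction_on with
  | empty => simp
  | cons e K ih => rw [Multiset.add_cons]; exact ih.trans (linkProb_le_cons e)

/-- Local replacement of a part of the graph, in the presence of edges from `T` only. -/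
lemma linkProb_add_le_add {T : Set (V × V)} {G₁ G₂ : Multiset ((V × V) × I)}
    (hG : ∀ e ∈ G, e.1 ∈ T) (h : ∀ S ⊆ T, linkProb A B G₁ S ≤ linkProb A B G₂ S) (hS : S ⊆ T) :
    linkProb A B (G + G₁) S ≤ linkProb A B (G + G₂) S := by
  induction G using Multiset.induction_on generalizing S with
  | empty => simpa using h S hS
  | cons e G ih =>
    rw [Multiset.cons_add, Multiset.cons_add, linkProb_cons, linkProb_cons]
    have hG' : ∀ e ∈ G, e.1 ∈ T := fun e he => hG e (Multiset.mem_cons_of_mem he)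
    exact convex_comb_le e.2.2.1 e.2.2.2
      (ih hG' (Set.insert_subset (hG e (Multiset.mem_cons_self e G)) hS)) (ih hG' hS)

lemma triangle_avg_le_star_avg {a b c : ℝ} (ha : a ∈ I) (hb : b ∈ I) (hc : c ∈ I)
    (h : kappaT a b c = 0) {f₀ fa fc fb fac fab fcb f g₀ g₁ g₂ g₃ g₁₂ g₁₃ g₂₃ g : ℝ}
    (h₀ : f₀ ≤ g₀) (h₁ : f₀ ≤ g₁) (h₂ : f₀ ≤ g₂) (h₃ : f₀ ≤ g₃)
    (h₁₂ : fa ≤ g₁₂) (h₁₃ : fc ≤ g₁₃) (h₂₃ : fb ≤ g₂₃)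
    (hac : fac ≤ g) (hab : fab ≤ g) (hcb : fcb ≤ g) (hf : f ≤ g) :
    a * (c * (b * f + (1 - b) * fac) + (1 - c) * (b * fab + (1 - b) * fa)) +
      (1 - a) * (c * (b * fcb + (1 - b) * fc) + (1 - c) * (b * fb + (1 - b) * f₀)) ≤
    (1 - b) * ((1 - c) * ((1 - a) * g + (1 - (1 - a)) * g₁₂) +
        (1 - (1 - c)) * ((1 - a) * g₁₃ + (1 - (1 - a)) * g₁)) +
      (1 - (1 - b)) * ((1 - c) * ((1 - a) * g₂₃ + (1 - (1 - a)) * g₂) +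
        (1 - (1 - c)) * ((1 - a) * g₃ + (1 - (1 - a)) * g₀)) := by
  have key : ∀ {u v w x y : ℝ}, 0 ≤ u → 0 ≤ v → 0 ≤ w → x ≤ y → 0 ≤ u * v * w * (y - x) :=
    fun hu hv hw h => mul_nonneg (mul_nonneg (mul_nonneg hu hv) hw) (sub_nonneg.2 h)
  have ha' := sub_nonneg.2 ha.2
  have hb' := sub_nonneg.2 hb.2
  have hc' := sub_nonneg.2 hc.2
  have k₀ : kappaT a b c * f₀ = 0 := by rw [h, zero_mul]
  have k₁ : kappaT a b c * g = 0 := by rw [h, zero_mul]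
  rw [kappaT] at k₀ k₁
  linarith [key ha.1 hb.1 hc.1 h₀, key ha.1 hb' hc.1 h₁, key ha.1 hb.1 hc' h₂,
    key ha' hb.1 hc.1 h₃, key ha.1 hb' hc' h₁₂, key ha' hb' hc.1 h₁₃, key ha' hb.1 hc' h₂₃,
    key ha.1 hb' hc.1 hac, key ha.1 hb.1 hc' hab, key ha' hb.1 hc.1 hcb, key ha.1 hb.1 hc.1 hf]

lemma star_avg_le_triangle_avg {a b c : ℝ} (ha : a ∈ I) (hb : b ∈ I) (hc : c ∈ I)
    (h : kappaT a b c = 0) {f₀ fa fc fb fac fab fcb f g₀ g₁ g₂ g₃ g₁₂ g₁₃ g₂₃ g : ℝ}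
    (h₀ : g₀ ≤ f₀) (h₁ : g₁ ≤ f₀) (h₂ : g₂ ≤ f₀) (h₃ : g₃ ≤ f₀)
    (h₁₂ : g₁₂ ≤ fa) (h₁₃ : g₁₃ ≤ fc) (h₂₃ : g₂₃ ≤ fb)
    (hac : g ≤ fac) (hab : g ≤ fab) (hcb : g ≤ fcb) (hf : g ≤ f) :
    (1 - b) * ((1 - c) * ((1 - a) * g + (1 - (1 - a)) * g₁₂) +
        (1 - (1 - c)) * ((1 - a) * g₁₃ + (1 - (1 - a)) * g₁)) +
      (1 - (1 - b)) * ((1 - c) * ((1 - a) * g₂₃ + (1 - (1 - a)) * g₂) +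
        (1 - (1 - c)) * ((1 - a) * g₃ + (1 - (1 - a)) * g₀)) ≤
    a * (c * (b * f + (1 - b) * fac) + (1 - c) * (b * fab + (1 - b) * fa)) +
      (1 - a) * (c * (b * fcb + (1 - b) * fc) + (1 - c) * (b * fb + (1 - b) * f₀)) := by
  have := triangle_avg_le_star_avg ha hb hc h (neg_le_neg h₀) (neg_le_neg h₁) (neg_le_neg h₂)
    (neg_le_neg h₃) (neg_le_neg h₁₂) (neg_le_neg h₁₃) (neg_le_neg h₂₃) (neg_le_neg hac)
    (neg_le_neg hab) (neg_le_neg hcb) (neg_le_neg hf)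
  linarith

lemma linkProb_zero_le_of_retract (f : V → V) (hA : ∀ a ∈ A, f a ∈ A) (hB : ∀ b ∈ B, f b ∈ B)
    (hS : ∀ g : V → Prop, (∀ e ∈ S', g e.1 = g e.2) → ∀ e ∈ S, g (f e.1) = g (f e.2)) :
    linkProb A B 0 S ≤ linkProb A B 0 S' :=
  linkProb_zero_le_of_imp (Linked.map f hA hB hS)

lemma linkProb_triangle_le_star {p₀ p₁ p₂ : I} (h : kappaT p₀ p₁ p₂ = 0) (x y z c : V) :
    linkProb A B ({((x, y), p₀)} + {((x, z), p₂)} + {((y, z), p₁)}) S ≤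
      linkProb A B ({((x, c), σ p₁)} + {((y, c), σ p₂)} + {((c, z), σ p₀)}) S := by
  simp only [add_assoc, linkProb_singleton_add, linkProb_singleton,
    unitInterval.coe_symm_eq]
  apply triangle_avg_le_star_avg p₀.2 p₁.2 p₂.2 h <;>
    refine linkProb_zero_le_of_retract id (fun _ => id) (fun _ => id) fun g hg => ?_ <;>
    simp only [Set.forall_mem_insert, id] at hg ⊢ <;> grind

lemma linkProb_edge_le_wedge {p₀ p₁ p₂ : I} (h : kappaT p₀ p₁ p₂ = 0) (x y c : V) :
    linkProb A B {((x, y), p₀)} S ≤ linkProb A B ({((x, c), σ p₁)} + {((y, c), σ p₂)}) S := by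
  simp only [linkProb_singleton_add, linkProb_singleton, unitInterval.coe_symm_eq]
  have h₁ : linkProb A B 0 (insert (x, y) S) ≤
      linkProb A B 0 (insert (y, c) (insert (x, c) S)) := by
    refine linkProb_zero_le_of_retract id (fun _ => id) (fun _ => id) fun g hg => ?_
    simp only [Set.forall_mem_insert, id] at hg ⊢
    grind
  have hm : ∀ {S'}, S ⊆ S' → linkProb A B 0 S ≤ linkProb A B 0 S' :=
    linkProb_mono subset_rfl subset_rfl
  have h₂ := hm ((Set.subset_insert (x, c) S).trans (Set.subset_insert (y, c) _))
  have h₃ := hm (Set.subset_insert (x, c) S)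
  have h₄ := hm (Set.subset_insert (y, c) S)
  have ha := sub_nonneg.2 p₀.2.2
  have hb := sub_nonneg.2 p₁.2.2
  have hc := sub_nonneg.2 p₂.2.2
  have hκ : ∀ t, kappaT p₀ p₁ p₂ * t = 0 := fun t => by rw [h, zero_mul]
  have k₁ := hκ (linkProb A B 0 S)
  have k₂ := hκ (linkProb A B 0 (insert (y, c) (insert (x, c) S)))
  rw [kappaT] at k₁ k₂
  have m₁ := mul_nonneg p₀.2.1 (sub_nonneg.2 h₁)
  have m₂ := mul_nonneg (mul_nonneg (mul_nonneg ha p₁.2.1) p₂.2.1) (sub_nonneg.2 h₂)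
  have m₃ := mul_nonneg (mul_nonneg hb p₂.2.1) (sub_nonneg.2 h₃)
  have m₄ := mul_nonneg (mul_nonneg p₁.2.1 hc) (sub_nonneg.2 h₄)
  linarith

open Classical in
lemma linkProb_star_le_triangle {p₀ p₁ p₂ : I} (h : kappaT p₀ p₁ p₂ = 0) {v x y z : V}
    (hx : x ≠ v) (hy : y ≠ v) (hz : z ≠ v) (hA : v ∈ A → x ∈ A ∧ y ∈ A ∧ z ∈ A)
    (hB : v ∈ B → x ∈ B ∧ y ∈ B ∧ z ∈ B) (hS : S ⊆ {e | e.1 ≠ v ∧ e.2 ≠ v}) :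
    linkProb A B ({((v, x), σ p₁)} + {((v, y), σ p₂)} + {((z, v), σ p₀)}) S ≤
      linkProb A B ({((y, x), p₀)} + {((z, x), p₂)} + {((z, y), p₁)}) S := by
  simp only [add_assoc, linkProb_singleton_add, linkProb_singleton, unitInterval.coe_symm_eq]
  have hr : ∀ {t : V} {S₁ S₂ : Set (V × V)}, (v ∈ A → t ∈ A) → (v ∈ B → t ∈ B) →
      (∀ g : V → Prop, (∀ e ∈ S₂, g e.1 = g e.2) →
        ∀ e ∈ S₁, g (if e.1 = v then t else e.1) = g (if e.2 = v then t else e.2)) →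
      linkProb A B 0 S₁ ≤ linkProb A B 0 S₂ := fun {t _ _} hA hB =>
    linkProb_zero_le_of_retract (fun w => if w = v then t else w)
      (fun a ha => by split_ifs with h; exacts [hA (h ▸ ha), ha])
      (fun b hb => by split_ifs with h; exacts [hB (h ▸ hb), hb])
  have hSv : ∀ e ∈ S, e.1 ≠ v ∧ e.2 ≠ v := hS
  apply star_avg_le_triangle_avg p₀.2 p₁.2 p₂.2 h
  on_goal 2 => refine hr (fun h => (hA h).1) (fun h => (hB h).1) fun g hg => ?_
  on_goal 3 => refine hr (fun h => (hA h).2.1) (fun h => (hB h).2.1) fun g hg => ?_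
  on_goal 4 => refine hr (fun h => (hA h).2.2) (fun h => (hB h).2.2) fun g hg => ?_
  on_goal 7 => refine hr (fun h => (hA h).2.1) (fun h => (hB h).2.1) fun g hg => ?_
  on_goal 1 => exact le_rfl
  all_goals try refine hr (fun h => (hA h).1) (fun h => (hB h).1) fun g hg => ?_
  all_goals
    simp only [Set.forall_mem_insert, if_true, if_neg hx, if_neg hy, if_neg hz] at hg ⊢
    grind

lemma linkProb_add_le_add_left {G₁ G₂ : Multiset ((V × V) × I)}
    (h : ∀ S, linkProb A B G₁ S ≤ linkProb A B G₂ S) :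
    linkProb A B (G + G₁) S ≤ linkProb A B (G + G₂) S :=
  linkProb_add_le_add (T := Set.univ) (fun _ _ => Set.mem_univ _) (fun S _ => h S)
    (Set.subset_univ S)

lemma linkProb_add_sum_le_add_sum {ι : Type} (s : Finset ι)
    {X Y : ι → Multiset ((V × V) × I)}
    (h : ∀ i S, linkProb A B (X i) S ≤ linkProb A B (Y i) S) :
    linkProb A B (G + ∑ i ∈ s, X i) S ≤ linkProb A B (G + ∑ i ∈ s, Y i) S := by
  classical
  induction s using Finset.induction_on generalizing G with
  | empty => simp
  | insert i s hi ih =>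
    rw [Finset.sum_insert hi, Finset.sum_insert hi, ← add_assoc, ← add_assoc, add_right_comm]
    refine (linkProb_add_le_add_left (h i)).trans ?_
    rw [add_right_comm]
    exact ih

/-- Simultaneous star-triangle transformation of stars with pairwise distinct centres in `C`. -/
lemma linkProb_add_sum_star_le {ι : Type} (s : Finset ι) {C : Set V} {v x y z : ι → V}
    {p₀ p₁ p₂ : I} (h : kappaT p₀ p₁ p₂ = 0) (hv : ∀ i, v i ∈ C) (hinj : v.Injective)
    (hx : ∀ i, x i ∉ C) (hy : ∀ i, y i ∉ C) (hz : ∀ i, z i ∉ C)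
    (hA : ∀ i, v i ∈ A → x i ∈ A ∧ y i ∈ A ∧ z i ∈ A)
    (hB : ∀ i, v i ∈ B → x i ∈ B ∧ y i ∈ B ∧ z i ∈ B)
    (hG : ∀ e ∈ G, e.1.1 ∉ C ∧ e.1.2 ∉ C) :
    linkProb A B
      (G + ∑ i ∈ s, ({((v i, x i), σ p₁)} + {((v i, y i), σ p₂)} + {((z i, v i), σ p₀)})) ∅ ≤
    linkProb A B
      (G + ∑ i ∈ s, ({((y i, x i), p₀)} + {((z i, x i), p₂)} + {((z i, y i), p₁)})) ∅ := by
  classical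
  induction s using Finset.induction_on generalizing G with
  | empty => simp
  | insert i s hi ih =>
    have hne : ∀ {w : V}, w ∉ C → ∀ j, w ≠ v j := fun hw j hj => hw (hj ▸ hv j)
    have hcomm : ∀ P Q : Multiset ((V × V) × I), G + (P + Q) = G + Q + P := fun P Q => by
      rw [add_comm P, add_assoc]
    rw [Finset.sum_insert hi, Finset.sum_insert hi, hcomm, hcomm]
    refine (linkProb_add_le_add (T := {e | e.1 ≠ v i ∧ e.2 ≠ v i}) ?_
      (fun S hS => linkProb_star_le_triangle h (hne (hx i) i) (hne (hy i) i) (hne (hz i) i)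
        (hA i) (hB i) hS) (Set.empty_subset _)).trans ?_
    · intro e he
      rcases Multiset.mem_add.1 he with he | he
      · exact ⟨hne (hG e he).1 i, hne (hG e he).2 i⟩
      · obtain ⟨j, hj, he⟩ := Multiset.mem_sum.1 he
        have hji : v j ≠ v i := hinj.ne (ne_of_mem_of_not_mem hj hi)
        simp only [Multiset.mem_add, Multiset.mem_singleton] at he
        rcases he with (rfl | rfl) | rfl
        exacts [⟨hji, hne (hx j) i⟩, ⟨hji, hne (hy j) i⟩, ⟨hne (hz j) i, hji⟩]
    · refine (congrArg (linkProb A B · ∅) (add_right_comm _ _ _)).trans_le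
        ((ih fun e he => ?_).trans_eq (congrArg (linkProb A B · ∅) (add_right_comm _ _ _)))
      simp only [Multiset.mem_add, Multiset.mem_singleton] at he
      rcases he with he | (rfl | rfl) | rfl
      exacts [hG e he, ⟨hy i, hx i⟩, ⟨hz i, hx i⟩, ⟨hz i, hy i⟩]

end LinkProb

/-- The `a`-th vertex of the `j`-th row of a piece of triangular lattice whose lowest row has
height `y`, in units of `(√3 / 2, 1 / 2)`. -/
def site (y a : ℤ) (j : ℕ) : ℤ × ℤ := (2 * a + j, y + 3 * j)

/-- A piece of triangular lattice with `n` strips and lowest row at height `y`. -/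
def triRegion (p₀ p₁ p₂ : I) (s : Finset ℤ) (n : ℕ) (y : ℤ) :
    Multiset (((ℤ × ℤ) × (ℤ × ℤ)) × I) :=
  ∑ j ∈ Finset.range (n + 1), ∑ a ∈ s, {((site y a j, site y (a + 1) j), p₀)} +
    ∑ j ∈ Finset.range n, ∑ a ∈ s, ({((site y a j, site y a (j + 1)), p₂)} +
      {((site y (a + 1) j, site y a (j + 1)), p₁)})

/-- A piece of square lattice with `m` strips, without the horizontal edges of the top row. -/
def sqRegion (p₀ : I) (s : Finset ℤ) (m : ℕ) : Multiset (((ℤ × ℤ) × (ℤ × ℤ)) × I) :=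
  ∑ j ∈ Finset.range m, ∑ a ∈ s, {((site (2 * j) a 0, site (2 * j) (a + 1) 0), p₀)} +
    ∑ j ∈ Finset.range m, ∑ a ∈ s, {((site (2 * j) a 0, site (2 * j + 2) a 0), σ p₀)}

/-- The sites lying weakly to the left of the line at distance `d` left of the origin. -/
def leftPart (d : ℝ) : Set (ℤ × ℤ) := {v | (v.1 : ℝ) ≤ -d}

/-- The sites lying weakly to the right of the line at distance `d` right of the origin. -/
def rightPart (d : ℝ) : Set (ℤ × ℤ) := {v | d ≤ (v.1 : ℝ)}

lemma sum_comp_le_sum {α : Type} {s t : Finset ℤ} (f : ℤ → Multiset α) {e : ℤ → ℤ}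
    (he : e.Injective) (h : ∀ a ∈ s, e a ∈ t) : ∑ a ∈ s, f (e a) ≤ ∑ a ∈ t, f a := by
  refine (Finset.sum_map s ⟨e, he⟩ f).symm.trans_le (Finset.sum_le_sum_of_subset fun b hb => ?_)
  obtain ⟨a, ha, rfl⟩ := Finset.mem_map.1 hb
  exact h a ha

lemma sqRegion_mono (p₀ : I) {s t : Finset ℤ} (h : s ⊆ t) (m : ℕ) :
    sqRegion p₀ s m ≤ sqRegion p₀ t m :=
  add_le_add (Finset.sum_le_sum fun _ _ => Finset.sum_le_sum_of_subset h)
    (Finset.sum_le_sum fun _ _ => Finset.sum_le_sum_of_subset h)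

/-- Transforming the upward triangles of the triangular region into stars. -/
lemma linkProb_triRegion_le_hexRegion {A B : Set (ℤ × ℤ)}
    {G : Multiset (((ℤ × ℤ) × (ℤ × ℤ)) × I)} {p₀ p₁ p₂ : I} (h : kappaT p₀ p₁ p₂ = 0)
    (s : Finset ℤ) (n : ℕ) (y : ℤ) :
    linkProb A B (G + triRegion p₀ p₁ p₂ s n (y + 2)) ∅ ≤
      linkProb A B (G + (∑ j ∈ Finset.range (n + 1), ∑ a ∈ s,
          ({((site (y + 2) a j, site y a (j + 1)), σ p₁)} +
            {((site (y + 2) (a + 1) j, site y a (j + 1)), σ p₂)}) +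
        ∑ j ∈ Finset.range n, ∑ a ∈ s,
          {((site y a (j + 1), site (y + 2) a (j + 1)), σ p₀)})) ∅ := by
  have e₁ : G + triRegion p₀ p₁ p₂ s n (y + 2) =
      G + ∑ a ∈ s, {((site (y + 2) a n, site (y + 2) (a + 1) n), p₀)} +
        ∑ i ∈ Finset.range n ×ˢ s,
          ({((site (y + 2) i.2 i.1, site (y + 2) (i.2 + 1) i.1), p₀)} +
            {((site (y + 2) i.2 i.1, site (y + 2) i.2 (i.1 + 1)), p₂)} +
            {((site (y + 2) (i.2 + 1) i.1, site (y + 2) i.2 (i.1 + 1)), p₁)}) := by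
    simp only [triRegion, Finset.sum_range_succ, Finset.sum_product, Finset.sum_add_distrib]
    abel
  rw [e₁]
  refine (linkProb_add_sum_le_add_sum _ (fun i S => linkProb_triangle_le_star h _ _ _
    (site y i.2 (i.1 + 1)))).trans ?_
  rw [add_right_comm]
  refine (linkProb_add_sum_le_add_sum _ (fun a S => linkProb_edge_le_wedge h _ _
    (site y a (n + 1)))).trans_eq (congrArg (linkProb A B · ∅) ?_)
  simp only [Finset.sum_range_succ, Finset.sum_product, Finset.sum_add_distrib]
  abel

/-- Transforming the stars of the hexagonal region into triangles. -/
lemma linkProb_hexRegion_le_triRegion {p₀ p₁ p₂ : I} (h : kappaT p₀ p₁ p₂ = 0)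
    {G : Multiset (((ℤ × ℤ) × (ℤ × ℤ)) × I)} {y : ℤ} (hG : ∀ e ∈ G, e.1.1.2 ≤ y ∧ e.1.2.2 ≤ y)
    (s : Finset ℤ) (n : ℕ) (d : ℝ) :
    linkProb (leftPart d) (rightPart d)
      (G + ∑ i ∈ Finset.range n ×ˢ s,
        ({((site (y + 2) i.2 i.1, site y i.2 (i.1 + 1)), σ p₁)} +
          {((site (y + 2) i.2 i.1, site y (i.2 - 1) (i.1 + 1)), σ p₂)} +
          {((site y i.2 i.1, site (y + 2) i.2 i.1), σ p₀)})) ∅ ≤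
    linkProb (leftPart (d - 1)) (rightPart (d - 1))
      (G + ∑ i ∈ Finset.range n ×ˢ s,
        ({((site y (i.2 - 1) (i.1 + 1), site y i.2 (i.1 + 1)), p₀)} +
          {((site y i.2 i.1, site y i.2 (i.1 + 1)), p₂)} +
          {((site y i.2 i.1, site y (i.2 - 1) (i.1 + 1)), p₁)})) ∅ := by
  set C : Set (ℤ × ℤ) := {v | y < v.2 ∧ (v.2 - y) % 3 = 2} with hC
  set A := leftPart d ∪ (leftPart (d - 1) \ C) with hA
  set B := rightPart d ∪ (rightPart (d - 1) \ C) with hB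
  have hA' : A ⊆ leftPart (d - 1) := Set.union_subset
    (fun v (hv : (v.1 : ℝ) ≤ -d) => show (v.1 : ℝ) ≤ -(d - 1) by linarith) Set.sdiff_subset
  have hB' : B ⊆ rightPart (d - 1) := Set.union_subset
    (fun v (hv : d ≤ (v.1 : ℝ)) => show d - 1 ≤ (v.1 : ℝ) by linarith) Set.sdiff_subset
  refine (linkProb_mono (A' := A) (B' := B) Set.subset_union_left Set.subset_union_left
    subset_rfl).trans (le_trans ?_ (linkProb_mono hA' hB' subset_rfl))
  have hx : ∀ i : ℕ × ℤ, site y i.2 (i.1 + 1) ∉ C := by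
    intro i; simp only [hC, site, Set.mem_ofPred_eq]; push_cast; omega
  have hy : ∀ i : ℕ × ℤ, site y (i.2 - 1) (i.1 + 1) ∉ C := by
    intro i; simp only [hC, site, Set.mem_ofPred_eq]; push_cast; omega
  have hz : ∀ i : ℕ × ℤ, site y i.2 i.1 ∉ C := by
    intro i; simp only [hC, site, Set.mem_ofPred_eq]; omega
  have hv : ∀ i : ℕ × ℤ, site (y + 2) i.2 i.1 ∈ C := by
    intro i; simp only [hC, site, Set.mem_ofPred_eq]; omega
  refine linkProb_add_sum_star_le _ h hv ?_ hx hy hz ?_ ?_ ?_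
  · rintro ⟨i, a⟩ ⟨j, b⟩ hij
    simp only [site, Prod.mk.injEq] at hij ⊢
    omega
  · intro i hi
    have hi' : (((site (y + 2) i.2 i.1).1 : ℤ) : ℝ) ≤ -d := hi.resolve_right fun h => h.2 (hv i)
    refine ⟨.inr ⟨?_, hx i⟩, .inr ⟨?_, hy i⟩, .inr ⟨?_, hz i⟩⟩ <;>
      simp only [leftPart, site, Set.mem_ofPred_eq] at hi' ⊢ <;> push_cast at hi' ⊢ <;> linarith
  · intro i hi
    have hi' : d ≤ (((site (y + 2) i.2 i.1).1 : ℤ) : ℝ) := hi.resolve_right fun h => h.2 (hv i)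
    refine ⟨.inr ⟨?_, hx i⟩, .inr ⟨?_, hy i⟩, .inr ⟨?_, hz i⟩⟩ <;>
      simp only [rightPart, site, Set.mem_ofPred_eq] at hi' ⊢ <;> push_cast at hi' ⊢ <;> linarith
  · intro e he
    have := hG e he
    simp only [hC, Set.mem_ofPred_eq]
    omega

/-- One step of the star-triangle evolution: the highest square strip is replaced by a
triangular one. -/
lemma linkProb_sqRegion_succ_add_triRegion_le {p₀ p₁ p₂ : I} (h : kappaT p₀ p₁ p₂ = 0)
    (M : ℤ) (m n : ℕ) (d : ℝ) :
    linkProb (leftPart d) (rightPart d) (sqRegion p₀ (Finset.Icc (-M) M) (m + 1) +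
        triRegion p₀ p₁ p₂ (Finset.Icc (-M) M) n (2 * m + 2)) ∅ ≤
      linkProb (leftPart (d - 1)) (rightPart (d - 1))
        (sqRegion p₀ (Finset.Icc (-(M + 2)) (M + 2)) m +
          triRegion p₀ p₁ p₂ (Finset.Icc (-(M + 2)) (M + 2)) (n + 1) (2 * m)) ∅ := by
  refine (linkProb_triRegion_le_hexRegion h _ _ _).trans ?_
  set s := Finset.Icc (-M) M with hs
  set t := Finset.Icc (-(M + 1)) (M + 1) with ht
  set u := Finset.Icc (-(M + 2)) (M + 2) with hu
  have hst : s ⊆ t := Finset.Icc_subset_Icc (by lia) (by lia)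
  have htu : t ⊆ u := Finset.Icc_subset_Icc (by lia) (by lia)
  set G := sqRegion p₀ s m + ∑ a ∈ s, {((site (2 * m) a 0, site (2 * m) (a + 1) 0), p₀)} with hG
  have hG' : ∀ e ∈ G, e.1.1.2 ≤ 2 * (m : ℤ) ∧ e.1.2.2 ≤ 2 * (m : ℤ) := by
    intro e he
    simp only [hG, sqRegion, Multiset.mem_add, Multiset.mem_sum, Finset.mem_range,
      Multiset.mem_singleton] at he
    rcases he with (⟨j, hj, a, ha, rfl⟩ | ⟨j, hj, a, ha, rfl⟩) | ⟨a, ha, rfl⟩ <;>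
      simp only [site] <;> push_cast <;> omega
  refine (linkProb_mono_graph ?_).trans
    ((linkProb_hexRegion_le_triRegion h hG' t (n + 1) d).trans (linkProb_mono_graph ?_))
  · have e₁ : sqRegion p₀ s (m + 1) =
        G + ∑ a ∈ s, {((site (2 * m) a 0, site (2 * m + 2) a 0), σ p₀)} := by
      simp only [hG, sqRegion, Finset.sum_range_succ]
      abel
    rw [e₁, add_assoc]
    refine add_le_add_right ?_ G
    simp only [Finset.sum_product, Finset.sum_add_distrib]
    rw [← add_assoc, add_comm (∑ a ∈ s, _), add_assoc, add_comm (∑ a ∈ s, _),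
      ← Finset.sum_range_succ' fun j =>
        ∑ a ∈ s, {((site (2 * m) a j, site (2 * m + 2) a j), σ p₀)}]
    refine add_le_add (add_le_add ?_ ?_) ?_ <;> refine Finset.sum_le_sum fun j _ => ?_
    · exact Finset.sum_le_sum_of_subset hst
    · refine le_of_eq_of_le (Finset.sum_congr rfl fun a _ => ?_) (sum_comp_le_sum
        (fun b => {((site (2 * m + 2) b j, site (2 * m) (b - 1) (j + 1)), σ p₂)})
        (add_left_injective 1) fun a ha => ?_)
      · simp
      · simp only [hs, ht, Finset.mem_Icc] at ha ⊢
        lia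
    · exact Finset.sum_le_sum_of_subset hst
  · have e₁ : triRegion p₀ p₁ p₂ u (n + 1) (2 * m) =
        ∑ a ∈ u, {((site (2 * m) a 0, site (2 * m) (a + 1) 0), p₀)} +
        (∑ j ∈ Finset.range (n + 1), ∑ a ∈ u,
          {((site (2 * m) a (j + 1), site (2 * m) (a + 1) (j + 1)), p₀)} +
        ∑ j ∈ Finset.range (n + 1), ∑ a ∈ u,
          {((site (2 * m) a j, site (2 * m) a (j + 1)), p₂)} +
        ∑ j ∈ Finset.range (n + 1), ∑ a ∈ u,
          {((site (2 * m) (a + 1) j, site (2 * m) a (j + 1)), p₁)}) := by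
      simp only [triRegion, Finset.sum_add_distrib]
      rw [Finset.sum_range_succ']
      abel
    rw [e₁, ← add_assoc]
    refine add_le_add (add_le_add (sqRegion_mono p₀ (hst.trans htu) m)
      (Finset.sum_le_sum_of_subset (hst.trans htu))) ?_
    simp only [Finset.sum_product, Finset.sum_add_distrib]
    have hmem : ∀ a ∈ t, a - 1 ∈ u := fun a ha => by
      simp only [hu, ht, Finset.mem_Icc] at ha ⊢
      lia
    refine add_le_add (add_le_add ?_ ?_) ?_ <;> refine Finset.sum_le_sum fun j _ => ?_
    · refine le_of_eq_of_le (Finset.sum_congr rfl fun a _ => ?_) (sum_comp_le_sum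
        (fun b => {((site (2 * m) b (j + 1), site (2 * m) (b + 1) (j + 1)), p₀)})
        (sub_left_injective (b := 1)) hmem)
      simp
    · exact Finset.sum_le_sum_of_subset htu
    · refine le_of_eq_of_le (Finset.sum_congr rfl fun a _ => ?_) (sum_comp_le_sum
        (fun b => {((site (2 * m) (b + 1) j, site (2 * m) b (j + 1)), p₁)})
        (sub_left_injective (b := 1)) hmem)
      simp

lemma linkProb_sqRegion_add_triRegion_le {p₀ p₁ p₂ : I} (h : kappaT p₀ p₁ p₂ = 0)
    (M : ℤ) (m n : ℕ) (d : ℝ) :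
    linkProb (leftPart d) (rightPart d) (sqRegion p₀ (Finset.Icc (-M) M) m +
        triRegion p₀ p₁ p₂ (Finset.Icc (-M) M) n (2 * m)) ∅ ≤
      linkProb (leftPart (d - m)) (rightPart (d - m))
        (triRegion p₀ p₁ p₂ (Finset.Icc (-(M + 2 * m)) (M + 2 * m)) (n + m) 0) ∅ := by
  induction m generalizing M n d with
  | zero => simp [sqRegion]
  | succ m ih =>
    have := (linkProb_sqRegion_succ_add_triRegion_le h M m n d).trans (ih (M + 2) (n + 1) (d - 1))
    have e₁ : 2 * ((m + 1 : ℕ) : ℤ) = 2 * m + 2 := by push_cast; ring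
    have e₂ : d - ((m + 1 : ℕ) : ℝ) = d - 1 - m := by push_cast; ring
    have e₃ : M + (2 * (m : ℤ) + 2) = M + 2 + 2 * m := by ring
    have e₄ : n + (m + 1) = n + 1 + m := by lia
    rw [e₁, e₂, e₃, e₄]
    exact this

lemma linkProb_nonneg {V : Type} {A B : Set V} (G : Multiset ((V × V) × I)) {S : Set (V × V)} :
    0 ≤ linkProb A B G S := by
  induction G using Multiset.induction_on generalizing S with
  | empty => rw [linkProb_zero]; split_ifs <;> norm_num
  | cons e G ih =>
    rw [linkProb_cons]
    exact add_nonneg (mul_nonneg e.2.2.1 ih) (mul_nonneg (sub_nonneg.2 e.2.2.2) ih)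

/-- The configurations agreeing with `f` on `t` and for which the open edges in `s` link `A` to
`B` have the expected probability. -/
lemma measure_linked_of_pattern {E V : Type} [DecidableEq E] {A B : Set V} {P : Measure (Config E)}
    {w : E → I} (hP : IsBernoulliProduct (fun e => (w e : ℝ)) P) (φ : E → V × V) (s : Finset E)
    (t : Finset E) (hst : Disjoint s t) (f : E → Bool) (S : Set (V × V)) :
    P {ω | (∀ e ∈ t, ω e = f e) ∧ Linked A B (S ∪ {x | ∃ e ∈ s, ω e = true ∧ φ e = x})} =
      P {ω | ∀ e ∈ t, ω e = f e} *
        ENNReal.ofReal (linkProb A B (∑ e ∈ s, {(φ e, w e)}) S) := by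
  induction s using Finset.induction_on generalizing t f S with
  | empty =>
    simp only [Finset.notMem_empty, false_and, exists_false, Set.ofPred_false, Set.union_empty,
      Finset.sum_empty, linkProb_zero]
    split_ifs with h <;> simp [h]
  | insert a s ha ih =>
    have hat : a ∉ t := Finset.disjoint_left.1 hst (Finset.mem_insert_self a s)
    have hst' : Disjoint s (insert a t) := by
      rw [Finset.disjoint_insert_right]
      exact ⟨ha, hst.mono_left (Finset.subset_insert a s)⟩
    have hm : MeasurableSet {ω : Config E | ω a = true} :=
      measurableSet_eq_fun (measurable_pi_apply a) measurable_const
    have hupd : ∀ (b : Bool) (ω : Config E),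
        (∀ e ∈ insert a t, ω e = Function.update f a b e) ↔ ω a = b ∧ ∀ e ∈ t, ω e = f e := by
      intro b ω
      rw [Finset.forall_mem_insert, Function.update_self]
      refine and_congr_right fun _ => forall₂_congr fun e he => ?_
      rw [Function.update_of_ne (ne_of_mem_of_not_mem he hat)]
    have hprob : ∀ b : Bool, P {ω | ∀ e ∈ insert a t, ω e = Function.update f a b e} =
        ENNReal.ofReal (if b then w a else 1 - w a) * P {ω | ∀ e ∈ t, ω e = f e} := by
      intro b
      rw [hP.2, hP.2, Finset.prod_insert hat, Function.update_self]
      congr 1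
      refine Finset.prod_congr rfl fun e he => ?_
      rw [Function.update_of_ne (ne_of_mem_of_not_mem he hat)]
    have hset : ∀ ω : Config E, {x | ∃ e ∈ insert a s, ω e = true ∧ φ e = x} =
        {x | ω a = true ∧ φ a = x} ∪ {x | ∃ e ∈ s, ω e = true ∧ φ e = x} := by
      intro ω
      ext x
      simp
    have h₁ := ih (insert a t) hst' (Function.update f a true) (insert (φ a) S)
    have h₂ := ih (insert a t) hst' (Function.update f a false) S
    simp only [hprob, if_true, Bool.false_eq_true, if_false] at h₁ h₂
    rw [← measure_inter_add_sdiff _ hm, Finset.sum_insert ha, linkProb_singleton_add,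
      ENNReal.ofReal_add, ENNReal.ofReal_mul, ENNReal.ofReal_mul, mul_add, ← mul_assoc, ← mul_assoc,
      mul_comm _ (ENNReal.ofReal (w a : ℝ)), mul_comm _ (ENNReal.ofReal (1 - (w a : ℝ))), ← h₁, ← h₂]
    · congr 2 <;> ext ω
      · simp only [Set.mem_inter_iff, Set.mem_ofPred_eq, hupd, hset]
        by_cases hω : ω a = true
        · have : S ∪ ({x | ω a = true ∧ φ a = x} ∪ {x | ∃ e ∈ s, ω e = true ∧ φ e = x}) =
              insert (φ a) S ∪ {x | ∃ e ∈ s, ω e = true ∧ φ e = x} := by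
            ext x
            simp only [hω, Set.mem_union, Set.mem_ofPred_eq, Set.mem_insert_iff, eq_comm (a := x)]
            tauto
          rw [this]
          tauto
        · tauto
      · simp only [Set.mem_sdiff, Set.mem_ofPred_eq, hupd, hset, Bool.not_eq_true]
        by_cases hω : ω a = true
        · simp [hω]
        · simp only [hω, Bool.false_eq_true, false_and, Set.ofPred_false, Set.empty_union]
          simp only [Bool.not_eq_true] at hω
          tauto
    · exact sub_nonneg.2 (w a).2.2
    · exact (w a).2.1
    · exact mul_nonneg (w a).2.1 (linkProb_nonneg _)
    · exact mul_nonneg (sub_nonneg.2 (w a).2.2) (linkProb_nonneg _)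

lemma measure_linked {E V : Type} [DecidableEq E] {A B : Set V} {P : Measure (Config E)}
    {w : E → I} (hP : IsBernoulliProduct (fun e => (w e : ℝ)) P) (φ : E → V × V) (s : Finset E) :
    P {ω | Linked A B {x | ∃ e ∈ s, ω e = true ∧ φ e = x}} =
      ENNReal.ofReal (linkProb A B (∑ e ∈ s, {(φ e, w e)}) ∅) := by
  have := hP.1
  simpa using measure_linked_of_pattern (A := A) (B := B) hP φ s ∅ (Finset.disjoint_empty_right s)
    (fun _ => true) ∅

/-- The endpoints of an edge of the stretched square lattice, in units of `(√3 / 2, 1 / 2)`. -/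
def sqEnds (e : SqE) : (ℤ × ℤ) × (ℤ × ℤ) :=
  ((2 * e.1, 2 * e.2.1), if e.2.2 then (2 * e.1 + 2, 2 * e.2.1) else (2 * e.1, 2 * e.2.1 + 2))

/-- The endpoints of an edge of the triangular lattice, in units of `(√3 / 2, 1 / 2)`. -/
def triEnds (e : TriE) : (ℤ × ℤ) × (ℤ × ℤ) :=
  if e.2.2 = 0 then
    ((2 * e.1 + e.2.1, 3 * e.2.1), (2 * (e.1 + 1) + e.2.1, 3 * e.2.1))
  else if e.2.2 = 1 then
    ((2 * (e.1 + 1) + e.2.1, 3 * e.2.1), (2 * e.1 + (e.2.1 + 1), 3 * (e.2.1 + 1)))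
  else ((2 * e.1 + e.2.1, 3 * e.2.1), (2 * e.1 + (e.2.1 + 1), 3 * (e.2.1 + 1)))

/-- The first `n` rows. -/
def rows (n : ℕ) : Finset ℤ := (Finset.range n).map Nat.castEmbedding

/-- The edges of the square lattice in `n` strips, starting in a column of `s`. -/
def sqBox (s : Finset ℤ) (n : ℕ) : Finset SqE :=
  s ×ˢ rows (n + 1) ×ˢ {true} ∪ s ×ˢ rows n ×ˢ {false}

/-- The edges of the triangular lattice in `n` strips, starting in a column of `s`. -/
def triBox (s : Finset ℤ) (n : ℕ) : Finset TriE :=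
  s ×ˢ rows (n + 1) ×ˢ {0} ∪ s ×ˢ rows n ×ˢ {1, 2}

lemma mem_rows {n : ℕ} {b : ℤ} : b ∈ rows n ↔ 0 ≤ b ∧ b < n := by
  simp only [rows, Finset.mem_map, Finset.mem_range, Nat.castEmbedding_apply]
  refine ⟨?_, fun h => ⟨b.toNat, by lia, by lia⟩⟩
  rintro ⟨k, hk, rfl⟩
  lia

lemma sum_sqBox (p : I) (s : Finset ℤ) (n : ℕ) :
    ∑ e ∈ sqBox s n, ({(sqEnds e, if e.2.2 then p else σ p)} : Multiset _) =
      sqRegion p s n + ∑ a ∈ s, {((site (2 * n) a 0, site (2 * n) (a + 1) 0), p)} := by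
  rw [sqBox, Finset.sum_union]
  · rw [Finset.sum_product_right, Finset.sum_product, Finset.sum_product_right, Finset.sum_product]
    simp only [Finset.sum_singleton, rows, Finset.sum_map, sqRegion, sqEnds, site,
      Finset.sum_range_succ, Nat.castEmbedding_apply, if_true, Bool.false_eq_true, if_false,
      Nat.cast_zero, add_zero, mul_zero, mul_add, mul_one]
    abel
  · rw [Finset.disjoint_left]
    simp only [Finset.mem_product, Finset.mem_singleton]
    rintro ⟨a, b, c⟩ ⟨-, -, h⟩ ⟨-, -, h'⟩
    simp_all

lemma sum_triBox (p₀ p₁ p₂ : I) (s : Finset ℤ) (n : ℕ) :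
    ∑ e ∈ triBox s n, ({(triEnds e, ![p₀, p₁, p₂] e.2.2)} : Multiset _) =
      triRegion p₀ p₁ p₂ s n 0 := by
  rw [triBox, Finset.sum_union]
  · rw [Finset.sum_product_right, Finset.sum_product, Finset.sum_product_right, Finset.sum_product]
    simp only [Finset.sum_singleton, rows, Finset.sum_map, triRegion, triEnds, site,
      Nat.castEmbedding_apply, zero_add, if_true, Matrix.cons_val_zero]
    refine congrArg₂ _ rfl (Finset.sum_congr rfl fun j _ => ?_)
    rw [Finset.sum_pair (by decide), add_comm, ← Finset.sum_add_distrib]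
    refine Finset.sum_congr rfl fun a _ => ?_
    simp
  · rw [Finset.disjoint_left]
    simp only [Finset.mem_product, Finset.mem_singleton]
    rintro ⟨a, b, c⟩ ⟨-, -, h⟩ ⟨-, -, h'⟩
    simp_all

/-- If a path is covered by finitely many segments, any two of which meet only when they share an
endpoint, then these segments link its endpoints. -/
lemma linked_of_path {V : Type} {A B : Set V} {S : Set (V × V)} {pos : V → Pt} (hS : S.Finite)
    (hmeet : ∀ x ∈ S, ∀ y ∈ S, ∀ z ∈ segment ℝ (pos x.1) (pos x.2),
      z ∈ segment ℝ (pos y.1) (pos y.2) → x.1 = y.1 ∨ x.1 = y.2 ∨ x.2 = y.1 ∨ x.2 = y.2)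
    {γ : ℝ → Pt} (hγ : ContinuousOn γ (Icc 0 1))
    (hcover : ∀ t ∈ Icc (0 : ℝ) 1, ∃ x ∈ S, γ t ∈ segment ℝ (pos x.1) (pos x.2))
    (hA : ∀ x ∈ S, γ 0 ∈ segment ℝ (pos x.1) (pos x.2) → x.1 ∈ A)
    (hB : ∀ x ∈ S, γ 1 ∈ segment ℝ (pos x.1) (pos x.2) → x.2 ∈ B) : Linked A B S := by
  set Q : V → Prop := fun v => ∃ a ∈ A, Relation.EqvGen (fun x y => (x, y) ∈ S) a v with hQ
  have hQS : ∀ x ∈ S, (Q x.1 ↔ Q x.2) := fun x hx =>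
    ⟨fun ⟨a, ha, h⟩ => ⟨a, ha, .trans _ _ _ h (.rel _ _ hx)⟩,
      fun ⟨a, ha, h⟩ => ⟨a, ha, .trans _ _ _ h (.symm _ _ (.rel _ _ hx))⟩⟩
  have hclosed : ∀ R : V × V → Prop,
      IsClosed (⋃ x ∈ {x ∈ S | R x}, segment ℝ (pos x.1) (pos x.2)) := fun R => by
    refine (hS.subset (Set.sep_subset S R)).isClosed_biUnion fun x _ => ?_
    rw [segment_eq_image_lineMap]
    exact (isCompact_Icc.image AffineMap.lineMap_continuous).isClosed
  have hK : IsPreconnected (γ '' Icc 0 1) := isPreconnected_Icc.image γ hγ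
  have h0 : (0 : ℝ) ∈ Icc (0 : ℝ) 1 := ⟨le_rfl, zero_le_one⟩
  have h1 : (1 : ℝ) ∈ Icc (0 : ℝ) 1 := ⟨zero_le_one, le_rfl⟩
  have hdisj : ∀ z, z ∈ (⋃ x ∈ {x ∈ S | Q x.1}, segment ℝ (pos x.1) (pos x.2)) →
      z ∉ (⋃ x ∈ {x ∈ S | ¬ Q x.1}, segment ℝ (pos x.1) (pos x.2)) := by
    intro z hz hz'
    simp only [Set.mem_iUnion₂, Set.mem_ofPred_eq] at hz hz'
    obtain ⟨x, ⟨hx, hQx⟩, hzx⟩ := hz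
    obtain ⟨y, ⟨hy, hQy⟩, hzy⟩ := hz'
    have hx' := (hQS x hx).1 hQx
    have hy' := (hQS y hy).not.1 hQy
    rcases hmeet x hx y hy z hzx hzy with h | h | h | h
    exacts [hQy (h ▸ hQx), hy' (h ▸ hQx), hQy (h ▸ hx'), hy' (h ▸ hx')]
  have hz₀ : γ 0 ∈ ⋃ x ∈ {x ∈ S | Q x.1}, segment ℝ (pos x.1) (pos x.2) := by
    obtain ⟨x, hx, hxz⟩ := hcover 0 h0
    exact Set.mem_biUnion (show x ∈ {x ∈ S | Q x.1} from ⟨hx, x.1, hA x hx hxz, .refl _⟩) hxz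
  have hsub := isPreconnected_iff_subset_of_disjoint_closed.1 hK _ _ (hclosed fun x => Q x.1)
    (hclosed fun x => ¬ Q x.1) ?_ ?_
  · rcases hsub with hsub | hsub
    · have := hsub (Set.mem_image_of_mem γ h1)
      simp only [Set.mem_iUnion₂, Set.mem_ofPred_eq] at this
      obtain ⟨x, ⟨hx, hQx⟩, hxz⟩ := this
      obtain ⟨a, ha, h⟩ := (hQS x hx).1 hQx
      exact ⟨a, ha, x.2, hB x hx hxz, h⟩
    · exact absurd (hsub (Set.mem_image_of_mem γ h0)) (hdisj _ hz₀)
  · rintro _ ⟨t, ht, rfl⟩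
    obtain ⟨x, hx, hxz⟩ := hcover t ht
    by_cases h : Q x.1
    · exact .inl (Set.mem_biUnion (show x ∈ {x ∈ S | Q x.1} from ⟨hx, h⟩) hxz)
    · exact .inr (Set.mem_biUnion (show x ∈ {x ∈ S | ¬ Q x.1} from ⟨hx, h⟩) hxz)
  · exact Set.eq_empty_of_forall_notMem fun z hz => hdisj z hz.2.1 hz.2.2

lemma eq_or_joinedIn_of_eqvGen {V : Type} {S : Set (V × V)} {pos : V → Pt} {U : Set Pt}
    (hS : ∀ x ∈ S, segment ℝ (pos x.1) (pos x.2) ⊆ U) {a b : V}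
    (h : Relation.EqvGen (fun x y => (x, y) ∈ S) a b) : a = b ∨ JoinedIn U (pos a) (pos b) := by
  induction h with
  | rel x y hxy =>
    refine .inr ((((convex_segment (pos x) (pos y)).isPathConnected
      ⟨_, left_mem_segment ℝ _ _⟩).joinedIn _ (left_mem_segment ℝ _ _) _
      (right_mem_segment ℝ _ _)).mono (hS _ hxy))
  | refl x => exact .inl rfl
  | symm x y _ ih => exact ih.imp Eq.symm JoinedIn.symm
  | trans x y z _ _ ih₁ ih₂ =>
    rcases ih₁ with rfl | ih₁
    · exact ih₂
    rcases ih₂ with rfl | ih₂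
    · exact .inr ih₁
    · exact .inr (ih₁.trans ih₂)

lemma ch_of_joinedIn {E : Type} {L : LatticeOn E} {ω : Config E} {m n : ℝ} (hm : 0 < m)
    {x y : Pt} (hx : x.1 ≤ -m) (hy : m ≤ y.1)
    (h : JoinedIn ({z | 0 ≤ z.2 ∧ z.2 ≤ n} ∩ openEdgeSet L ω) x y) : Ch L m n ω := by
  obtain ⟨γ, hγ⟩ := h
  have hmem : ∀ t, γ.extend t ∈ {z : Pt | 0 ≤ z.2 ∧ z.2 ≤ n} ∩ openEdgeSet L ω := by
    intro t
    have : γ.extend t ∈ Set.range γ := γ.extend_range ▸ Set.mem_range_self t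
    obtain ⟨s, hs⟩ := this
    exact hs ▸ hγ s
  have hc : Continuous fun t => (γ.extend t).1 := continuous_fst.comp γ.continuous_extend
  set f : ℝ → ℝ := fun t => (γ.extend t).1 with hf
  have hf0 : f 0 ≤ -m := by simpa [hf] using hx
  have hf1 : m ≤ f 1 := by simpa [hf] using hy
  obtain ⟨u, ⟨hu, hmu⟩, hul⟩ := (isCompact_Icc.inter_right (isClosed_le continuous_const hc) :
    IsCompact (Icc (0 : ℝ) 1 ∩ {t | m ≤ f t})).exists_isLeast ⟨1, ⟨zero_le_one, le_rfl⟩, hf1⟩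
  have hlt : ∀ t ∈ Icc (0 : ℝ) u, f t ≤ m := by
    intro t ht
    by_contra! hmt
    obtain ⟨s, hs, hsm⟩ := intermediate_value_Icc ht.1 hc.continuousOn ⟨by linarith, hmt.le⟩
    have := hul ⟨⟨hs.1, hs.2.trans (ht.2.trans hu.2)⟩, hsm.ge⟩
    have : s = t := le_antisymm hs.2 (ht.2.trans this)
    exact hmt.ne' (this ▸ hsm)
  have hfu : f u = m := le_antisymm (hlt u ⟨hu.1, le_rfl⟩) hmu
  obtain ⟨l, ⟨hl, hml⟩, hlg⟩ := (isCompact_Icc.inter_right (isClosed_le hc continuous_const) :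
    IsCompact (Icc (0 : ℝ) u ∩ {t | f t ≤ -m})).exists_isGreatest ⟨0, ⟨le_rfl, hu.1⟩, hf0⟩
  have hgt : ∀ t ∈ Icc l u, -m ≤ f t := by
    intro t ht
    by_contra! hmt
    obtain ⟨s, hs, hsm⟩ := intermediate_value_Icc ht.2 hc.continuousOn
      (show -m ∈ Icc (f t) (f u) from ⟨hmt.le, by linarith⟩)
    have := hlg ⟨⟨hl.1.trans (ht.1.trans hs.1), hs.2⟩, hsm.le⟩
    have : s = t := le_antisymm (this.trans ht.1) hs.1
    exact hmt.ne (this ▸ hsm)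
  have hfl : f l = -m := le_antisymm hml (hgt l ⟨le_rfl, hl.2⟩)
  refine ⟨fun t => γ.extend (l + t * (u - l)), ?_, ?_, ?_, fun t ht => ?_⟩
  · exact (γ.continuous_extend.comp (by fun_prop)).continuousOn
  · simpa [hf] using ⟨hfl, (hmem l).1⟩
  · simpa [hf] using ⟨hfu, (hmem u).1⟩
  · have h₁ : 0 ≤ u - l := sub_nonneg.2 hl.2
    have h₂ : l + t * (u - l) ∈ Icc l u :=
      ⟨by nlinarith [ht.1], by nlinarith [ht.2]⟩
    exact ⟨⟨hgt _ h₂, hlt _ ⟨hl.1.trans h₂.1, h₂.2⟩, (hmem _).1⟩, (hmem _).2⟩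

/-- The position in the plane of the point with coordinates `v` in units of `(√3 / 2, 1 / 2)`. -/
noncomputable def position (v : ℤ × ℤ) : Pt := (√3 / 2 * v.1, v.2 / 2)

lemma position_le_position {u v : ℤ × ℤ} : position u ≤ position v ↔ u ≤ v := by
  have h : (0 : ℝ) < √3 / 2 := by positivity
  simp only [position, Prod.le_def, mul_le_mul_iff_right₀ h,
    div_le_div_iff_of_pos_right (zero_lt_two (α := ℝ)), Int.cast_le]

lemma sqStretch_ends (e : SqE) :
    sqStretch.ends e = (position (sqEnds e).1, position (sqEnds e).2) := by
  rcases e with ⟨a, b, c⟩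
  cases c <;> simp only [sqStretch, sqEnds, position] <;> simp <;> (try constructor) <;> ring

lemma triLattice_ends (e : TriE) :
    triLattice.ends e = (position (triEnds e).1, position (triEnds e).2) := by
  rcases e with ⟨a, b, c⟩
  fin_cases c <;> simp [triLattice, triEnds, position, tv] <;> refine ⟨⟨?_, ?_⟩, ?_, ?_⟩ <;> ring

lemma sqEnds_le (e : SqE) : (sqEnds e).1 ≤ (sqEnds e).2 := by
  rcases e with ⟨a, b, c⟩
  cases c <;> simp [sqEnds]

/-- A point of the box on an open edge either lies on an edge of the box, or is a vertex. -/
lemma exists_segment_of_mem_sqEnds {r : ℝ} {N : ℕ} {M : ℤ} (hM : r + 1 ≤ M) {ω : Config SqE}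
    {z : Pt} (hz : -r ≤ z.1 ∧ z.1 ≤ r ∧ 0 ≤ z.2 ∧ z.2 ≤ N) {e : SqE} (hω : ω e = true)
    (he : z ∈ segment ℝ (position (sqEnds e).1) (position (sqEnds e).2)) :
    ∃ x ∈ {x | ∃ e ∈ sqBox (Finset.Icc (-M) M) N, ω e = true ∧ sqEnds e = x} ∪
      (fun q : ℤ × ℤ => ((2 * q.1, 2 * q.2), (2 * q.1, 2 * q.2))) ''
        (↑(Finset.Icc (-M) M ×ˢ rows (N + 1)) : Set (ℤ × ℤ)),
      z ∈ segment ℝ (position x.1) (position x.2) := by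
  set S := {x | ∃ e ∈ sqBox (Finset.Icc (-M) M) N, ω e = true ∧ sqEnds e = x} ∪
      (fun q : ℤ × ℤ => ((2 * q.1, 2 * q.2), (2 * q.1, 2 * q.2))) ''
        (↑(Finset.Icc (-M) M ×ˢ rows (N + 1)) : Set (ℤ × ℤ))
  have hle := segment_subset_Icc (position_le_position.2 (sqEnds_le e)) he
  have h3 : (1 : ℝ) ≤ √3 := Real.one_le_sqrt.2 (by norm_num)
  have hr : 0 ≤ r := by linarith
  rcases e with ⟨a, b, c⟩
  obtain ⟨⟨h₁, h₂⟩, h₃, h₄⟩ := hle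
  have ha₁ : a ≤ M := by
    have h₁ : √3 / 2 * (2 * a : ℤ) ≤ z.1 := h₁
    by_contra! h
    have : (M : ℝ) < a := by exact_mod_cast h
    push_cast at h₁
    nlinarith
  have ha₂ : -M ≤ a := by
    have h₃ : z.1 ≤ √3 / 2 * (2 * a + 2 : ℤ) := by
      refine h₃.trans (mul_le_mul_of_nonneg_left (Int.cast_le.2 ?_) (by positivity))
      cases c <;> simp [sqEnds]
    by_contra! h
    have : (a : ℝ) < -M := by exact_mod_cast h
    push_cast at h₃
    nlinarith
  have ha : a ∈ Finset.Icc (-M) M := Finset.mem_Icc.2 ⟨ha₂, ha₁⟩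
  have hvertex : ∀ k ∈ rows (N + 1), z = position (2 * a, 2 * k) →
      ∃ x ∈ S, z ∈ segment ℝ (position x.1) (position x.2) := fun k hk hzk =>
    ⟨((2 * a, 2 * k), (2 * a, 2 * k)), .inr ⟨(a, k), by simpa using ⟨Finset.mem_Icc.1 ha, hk⟩, rfl⟩,
      hzk ▸ left_mem_segment ℝ _ _⟩
  have hedge : (a, b, c) ∈ sqBox (Finset.Icc (-M) M) N →
      ∃ x ∈ S, z ∈ segment ℝ (position x.1) (position x.2) := fun hmem =>
    ⟨sqEnds (a, b, c), .inl ⟨(a, b, c), hmem, hω, rfl⟩, he⟩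
  cases c
  · have h₁ : √3 / 2 * (2 * a : ℤ) ≤ z.1 := h₁
    have h₂ : ((2 * b : ℤ) : ℝ) / 2 ≤ z.2 := h₂
    have h₃ : z.1 ≤ √3 / 2 * (2 * a : ℤ) := h₃
    have h₄ : z.2 ≤ ((2 * b + 2 : ℤ) : ℝ) / 2 := h₄
    push_cast at h₁ h₂ h₃ h₄
    have hb₁ : b ≤ N := by
      have : (b : ℝ) ≤ N := by linarith
      exact_mod_cast this
    have hb₂ : -1 ≤ b := by
      have : (-1 : ℝ) ≤ b := by linarith
      exact_mod_cast this
    rcases hb₂.eq_or_lt with rfl | hb₂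
    · refine hvertex 0 (mem_rows.2 ⟨le_rfl, by positivity⟩) (Prod.ext ?_ ?_)
      · simp only [position]; push_cast; linarith
      · simp only [position]; push_cast at h₄ ⊢; linarith
    rcases hb₁.eq_or_lt with rfl | hb₁
    · refine hvertex N (mem_rows.2 ⟨by positivity, by lia⟩) (Prod.ext ?_ ?_)
      · simp only [position]; push_cast; linarith
      · simp only [position]; push_cast at h₂ ⊢; linarith
    · refine hedge ?_
      simp only [sqBox, Finset.mem_union, Finset.mem_product, mem_rows, Finset.mem_singleton]
      exact .inr ⟨ha, ⟨by lia, hb₁⟩, trivial⟩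
  · have h₂ : ((2 * b : ℤ) : ℝ) / 2 ≤ z.2 := h₂
    have h₄ : z.2 ≤ ((2 * b : ℤ) : ℝ) / 2 := h₄
    push_cast at h₂ h₄
    have hb₁ : b ≤ N := by
      have : (b : ℝ) ≤ N := by linarith
      exact_mod_cast this
    have hb₂ : 0 ≤ b := by
      have : (0 : ℝ) ≤ b := by linarith
      exact_mod_cast this
    refine hedge ?_
    simp only [sqBox, Finset.mem_union, Finset.mem_product, mem_rows, Finset.mem_singleton]
    exact .inl ⟨ha, ⟨hb₂, by lia⟩, trivial⟩

lemma linked_of_ch_sqStretch {r d : ℝ} {N : ℕ} {M : ℤ} (hd : √3 / 2 * d = r) (hM : r + 1 ≤ M)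
    {ω : Config SqE} (h : Ch sqStretch r N ω) :
    Linked (leftPart d) (rightPart d)
      {x | ∃ e ∈ sqBox (Finset.Icc (-M) M) N, ω e = true ∧ sqEnds e = x} := by
  set s := Finset.Icc (-M) M with hs
  obtain ⟨γ, hγ, h0, h1, hmem⟩ := h
  set S := {x | ∃ e ∈ sqBox s N, ω e = true ∧ sqEnds e = x} with hS
  set S' := S ∪ ((fun q : ℤ × ℤ => ((2 * q.1, 2 * q.2), (2 * q.1, 2 * q.2))) ''
    (↑(s ×ˢ rows (N + 1)) : Set (ℤ × ℤ))) with hS'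
  have hfin : S'.Finite := by
    refine Set.Finite.union ?_ ((Finset.finite_toSet _).image _)
    refine ((sqBox s N).finite_toSet.image sqEnds).subset ?_
    rintro x ⟨e, he, -, rfl⟩
    exact Set.mem_image_of_mem _ he
  have hshape : ∀ x ∈ S', ∃ a b : ℤ, x.1 = (2 * a, 2 * b) ∧
      (x.2 = (2 * a, 2 * b) ∨ x.2 = (2 * a + 2, 2 * b) ∨ x.2 = (2 * a, 2 * b + 2)) := by
    rintro x (⟨⟨a, b, c⟩, -, -, rfl⟩ | ⟨⟨a, b⟩, -, rfl⟩)
    · refine ⟨a, b, rfl, ?_⟩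
      cases c <;> simp [sqEnds]
    · exact ⟨a, b, rfl, .inl rfl⟩
  have hle : ∀ x ∈ S', ∀ z ∈ segment ℝ (position x.1) (position x.2),
      position x.1 ≤ z ∧ z ≤ position x.2 := by
    intro x hx z hz
    refine segment_subset_Icc (position_le_position.2 ?_) hz
    obtain ⟨a, b, h₁, h₂ | h₂ | h₂⟩ := hshape x hx <;> rw [h₁, h₂] <;>
      simp only [Prod.mk_le_mk] <;> lia
  have hlink : Linked (leftPart d) (rightPart d) S' := by
    refine linked_of_path (pos := position) hfin ?_ hγ ?_ ?_ ?_
    · intro x hx y hy z hzx hzy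
      have h₁ := position_le_position.1 ((hle x hx z hzx).1.trans (hle y hy z hzy).2)
      have h₂ := position_le_position.1 ((hle y hy z hzy).1.trans (hle x hx z hzx).2)
      obtain ⟨a, b, e₁, e₂⟩ := hshape x hx
      obtain ⟨a', b', e₁', e₂'⟩ := hshape y hy
      rw [e₁] at h₁
      rw [e₁'] at h₂
      rcases e₂ with e₂ | e₂ | e₂ <;> rcases e₂' with e₂' | e₂' | e₂' <;>
        rw [e₂] at h₂ <;> rw [e₂'] at h₁ <;> rw [e₁, e₂, e₁', e₂'] <;>
        simp only [Prod.mk_le_mk, Prod.mk.injEq] at h₁ h₂ ⊢ <;> lia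
    · intro t ht
      obtain ⟨hbox, hopen⟩ := hmem t ht
      simp only [openEdgeSet, Set.mem_iUnion₂] at hopen
      obtain ⟨e, hω, hz⟩ := hopen
      rw [sqStretch_ends] at hz
      exact exists_segment_of_mem_sqEnds hM hbox hω hz
    · intro x hx hz
      have := (hle x hx _ hz).1.1
      rw [h0.1, ← hd] at this
      simp only [leftPart, Set.mem_ofPred_eq, position] at this ⊢
      have h3 : (0 : ℝ) < √3 / 2 := by positivity
      nlinarith
    · intro x hx hz
      have := (hle x hx _ hz).2.1
      rw [h1.1, ← hd] at this
      simp only [rightPart, Set.mem_ofPred_eq, position] at this ⊢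
      have h3 : (0 : ℝ) < √3 / 2 := by positivity
      nlinarith
  refine hlink.map id (fun _ => id) (fun _ => id) fun g hg x hx => ?_
  rcases hx with hx | ⟨q, -, rfl⟩
  · exact hg x hx
  · rfl

lemma ch_triLattice_of_linked {α d : ℝ} {N : ℕ} {s : Finset ℤ} (hα : 1 < α) (hN : 1 ≤ N)
    (hd : √3 / 2 * d = α * N) {ω : Config TriE}
    (h : Linked (leftPart (d - N)) (rightPart (d - N))
      {x | ∃ e ∈ triBox s N, ω e = true ∧ triEnds e = x}) :
    Ch triLattice ((α - 1) * N) (2 * N) ω := by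
  have h3 : (0 : ℝ) < √3 / 2 := by positivity
  have h3' : √3 / 2 ≤ 1 := by
    rw [div_le_one two_pos, Real.sqrt_le_left two_pos.le]
    norm_num
  have hN' : (0 : ℝ) < N := by exact_mod_cast hN
  have hm : 0 < (α - 1) * N := mul_pos (sub_pos.2 hα) hN'
  have hle : (α - 1) * N ≤ √3 / 2 * (d - N) := by
    rw [mul_sub, hd]
    nlinarith
  obtain ⟨a, ha, b, hb, hab⟩ := h
  have ha' : (position a).1 ≤ -((α - 1) * N) := by
    have : (a.1 : ℝ) ≤ -(d - N) := ha
    simp only [position]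
    nlinarith
  have hb' : (α - 1) * N ≤ (position b).1 := by
    have : d - N ≤ (b.1 : ℝ) := hb
    simp only [position]
    nlinarith
  refine ch_of_joinedIn hm ha' hb' ((eq_or_joinedIn_of_eqvGen ?_ hab).resolve_left ?_)
  · rintro _ ⟨e, he, hω, rfl⟩
    refine Set.subset_inter ?_ ?_
    · have hconv : Convex ℝ {z : Pt | 0 ≤ z.2 ∧ z.2 ≤ 2 * N} :=
        (convex_Icc (0 : ℝ) (2 * N)).linear_preimage (LinearMap.snd ℝ ℝ ℝ)
      have hrow : (0 ≤ (triEnds e).1.2 ∧ (triEnds e).1.2 ≤ 3 * (N : ℤ)) ∧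
          0 ≤ (triEnds e).2.2 ∧ (triEnds e).2.2 ≤ 3 * (N : ℤ) := by
        rcases e with ⟨a, b, c⟩
        simp only [triBox, Finset.mem_union, Finset.mem_product, mem_rows, Finset.mem_singleton,
          Finset.mem_insert] at he
        rcases he with ⟨-, hb, rfl⟩ | ⟨-, hb, rfl | rfl⟩ <;>
          simp [triEnds] <;> lia
      have hpos : ∀ v : ℤ × ℤ, 0 ≤ v.2 ∧ v.2 ≤ 3 * (N : ℤ) →
          position v ∈ {z : Pt | 0 ≤ z.2 ∧ z.2 ≤ 2 * N} := by
        rintro v ⟨h₁, h₂⟩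
        have h₁' : (0 : ℝ) ≤ v.2 := by exact_mod_cast h₁
        have h₂' : (v.2 : ℝ) ≤ 3 * N := by exact_mod_cast h₂
        simp only [position, Set.mem_ofPred_eq]
        constructor <;> linarith
      exact hconv.segment_subset (hpos _ hrow.1) (hpos _ hrow.2)
    · intro z hz
      rw [openEdgeSet]
      refine Set.mem_biUnion (show e ∈ {e | ω e = true} from hω) ?_
      rwa [triLattice_ends]
  · rintro rfl
    linarith

/-- For self-dual `p = (p0,p1,p2) ∈ [0,1)³` with `p0 > 0`, every
`α > 1` and every `N ∈ ℕ`: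
`P^△_p[C_h((α-1)N, 2N)] ≥ P^□_{(p0,1-p0)}[C_h(αN, N)]`, where the square lattice has
horizontal edges of length `√3` and vertical edges of length `1`. -/
theorem horizontal_crossing_square_to_triangle (p0 p1 p2 : ℝ)
    (h0 : p0 ∈ Set.Ico (0 : ℝ) 1) (h1 : p1 ∈ Set.Ico (0 : ℝ) 1)
    (h2 : p2 ∈ Set.Ico (0 : ℝ) 1) (hsd : kappaT p0 p1 p2 = 0) (hp0 : 0 < p0)
    (PT : Measure (Config TriE)) (hPT : IsBernoulliProduct (triInt p0 p1 p2) PT)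
    (PS : Measure (Config SqE)) (hPS : IsBernoulliProduct (sqInt p0 (1 - p0)) PS)
    (α : ℝ) (hα : 1 < α) (N : ℕ) (hN : 1 ≤ N) :
    PS {ω | Ch sqStretch (α * N) N ω} ≤
      PT {ω | Ch triLattice ((α - 1) * N) (2 * N) ω} := by
  obtain ⟨q₀, rfl⟩ : ∃ q : I, (q : ℝ) = p0 := ⟨⟨p0, h0.1, h0.2.le⟩, rfl⟩
  obtain ⟨q₁, rfl⟩ : ∃ q : I, (q : ℝ) = p1 := ⟨⟨p1, h1.1, h1.2.le⟩, rfl⟩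
  obtain ⟨q₂, rfl⟩ : ∃ q : I, (q : ℝ) = p2 := ⟨⟨p2, h2.1, h2.2.le⟩, rfl⟩
  have hS : sqInt q₀ (1 - q₀) = fun e => (((if e.2.2 then q₀ else σ q₀) : I) : ℝ) := by
    funext e
    simp only [sqInt]
    split_ifs <;> simp
  have hT : triInt q₀ q₁ q₂ = fun e => ((![q₀, q₁, q₂] e.2.2 : I) : ℝ) := by
    funext e
    rcases e with ⟨a, b, c⟩
    fin_cases c <;> rfl
  rw [hS] at hPS
  rw [hT] at hPT
  obtain ⟨M, hM⟩ := exists_int_gt (α * N + 1)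
  set d : ℝ := α * N / (√3 / 2) with hd
  have hd' : √3 / 2 * d = α * N := mul_div_cancel₀ _ (by positivity)
  have key := linkProb_sqRegion_add_triRegion_le hsd M N 0 d
  have e₁ : triRegion q₀ q₁ q₂ (Finset.Icc (-M) M) 0 (2 * N) =
      ∑ a ∈ Finset.Icc (-M) M, {((site (2 * N) a 0, site (2 * N) (a + 1) 0), q₀)} := by
    simp [triRegion]
  rw [e₁, ← sum_sqBox, zero_add, ← sum_triBox] at key
  calc PS {ω | Ch sqStretch (α * N) N ω}
      ≤ PS {ω | Linked (leftPart d) (rightPart d)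
          {x | ∃ e ∈ sqBox (Finset.Icc (-M) M) N, ω e = true ∧ sqEnds e = x}} :=
        measure_mono fun ω hω => linked_of_ch_sqStretch hd' hM.le hω
    _ = _ := measure_linked hPS _ _
    _ ≤ _ := ENNReal.ofReal_le_ofReal key
    _ = _ := (measure_linked hPT _ _).symm
    _ ≤ PT {ω | Ch triLattice ((α - 1) * N) (2 * N) ω} :=
        measure_mono fun ω hω => ch_triLattice_of_linked hα hN hd' hω

end Perc
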